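/- Let m ≥ 0 and let s be an integer with 0 ≤ s ≤ m. In the Laurent polynomial ring ℤ[u, v][Y_1^{±1}, …, Y_m^{±1}], the following identity holds: e_{2m−s}(u Y_1, v Y_1^{−1}, u Y_2, v Y_2^{−1}, …, u Y_m, v Y_m^{−1}) = (u v)^{m−s} · e_s(u Y_1, v Y_1^{−1}, u Y_2, v Y_2^{−1}, …, u Y_m, v Y_m^{−1}), where both elementary symmetric polynomials are evaluated at the same 2m quantities u Y_1, v Y_1^{−1}, …, u Y_m, v Y_m^{−1}. -/

import Mathlib

noncomputable section

/-- Elementary symmetric polynomial of degree `m` evaluated at the list `l`;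
zero for `m` larger than the length of `l`. -/
def epow {R : Type*} [CommSemiring R] : ℕ → List R → R
  | 0, _ => 1
  | _ + 1, [] => 0
  | m + 1, x :: xs => epow (m + 1) xs + x * epow m xs

/-- The coefficient ring `ℤ[u, v]`. -/
abbrev CoeffR : Type := MvPolynomial (Fin 2) ℤ

/-- The Laurent polynomial ring `ℤ[u, v][Y_1^{±1}, …, Y_m^{±1}]`. -/
abbrev LPm (m : ℕ) : Type := AddMonoidAlgebra CoeffR (Fin m →₀ ℤ)

/-- The indeterminate `u`. -/
def uL (m : ℕ) : LPm m := AddMonoidAlgebra.single 0 (MvPolynomial.X 0)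

/-- The indeterminate `v`. -/
def vL (m : ℕ) : LPm m := AddMonoidAlgebra.single 0 (MvPolynomial.X 1)

/-- The monomial `Y_i`. -/
def YL (m : ℕ) (i : Fin m) : LPm m := AddMonoidAlgebra.single (Finsupp.single i 1) 1

/-- The monomial `Y_i^{−1}`. -/
def YLinv (m : ℕ) (i : Fin m) : LPm m := AddMonoidAlgebra.single (Finsupp.single i (-1)) 1

/-- The `2m` quantities `(u Y_1, v Y_1^{−1}, u Y_2, v Y_2^{−1}, …, u Y_m, v Y_m^{−1})`. -/
def argL (m : ℕ) : List (LPm m) :=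
  (List.finRange m).flatMap fun i => [uL m * YL m i, vL m * YLinv m i]

theorem epow_eq_zero_of_length_lt {R : Type*} [CommSemiring R] :
    ∀ (l : List R) (n : ℕ), l.length < n → epow n l = 0
  | _, 0, h => absurd h (Nat.not_lt_zero _)
  | [], _ + 1, _ => rfl
  | x :: xs, n + 1, h => by
    have h' : xs.length < n := by simpa using h
    rw [epow, epow_eq_zero_of_length_lt xs (n + 1) (h'.trans n.lt_succ_self),
      epow_eq_zero_of_length_lt xs n h', mul_zero, add_zero]

theorem epow_zero {R : Type*} [CommSemiring R] (l : List R) : epow 0 l = 1 := by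
  cases l <;> rfl

theorem epow_one_cons_cons {R : Type*} [CommSemiring R] (x y : R) (l : List R) :
    epow 1 (x :: y :: l) = epow 1 l + (x + y) := by
  simp only [epow, epow_zero]
  ring

theorem epow_add_two_cons_cons {R : Type*} [CommSemiring R] (n : ℕ) (x y : R) (l : List R) :
    epow (n + 2) (x :: y :: l) = epow (n + 2) l + (x + y) * epow (n + 1) l + x * y * epow n l := by
  simp only [epow]
  ring

/-- Reflection of elementary symmetric polynomials evaluated at a list of pairs with constant
product `c`. -/
theorem epow_flatMap_pair_reflection {R ι : Type*} [CommSemiring R] {c : R} {f g : ι → R}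
    (hfg : ∀ i, f i * g i = c) (l : List ι) {s k : ℕ} (hsk : s + k = l.length) :
    epow (l.length + k) (l.flatMap fun i => [f i, g i]) =
      c ^ k * epow s (l.flatMap fun i => [f i, g i]) := by
  induction l generalizing s k with
  | nil =>
    obtain ⟨rfl, rfl⟩ : s = 0 ∧ k = 0 := by simpa using hsk
    simp
  | cons i l ih =>
    have hlen : (l.flatMap fun i => [f i, g i]).length = 2 * l.length := by
      simp [List.length_flatMap, mul_comm]
    simp only [List.flatMap_cons, List.cons_append, List.nil_append, List.length_cons] at hsk ⊢
    set L := l.flatMap fun i => [f i, g i]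
    rcases k with _ | k
    · simp [← hsk]
    rw [show l.length + 1 + (k + 1) = l.length + k + 2 by ring, epow_add_two_cons_cons, hfg]
    rcases s with _ | _ | s
    · have h : k = l.length := by omega
      rw [epow_eq_zero_of_length_lt L (l.length + k + 2) (by omega),
        epow_eq_zero_of_length_lt L (l.length + k + 1) (by omega),
        ih (s := 0) (by omega), epow_zero, epow_zero]
      ring
    · rw [epow_eq_zero_of_length_lt L (l.length + k + 2) (by omega), add_assoc l.length k 1,
        ih (s := 0) (k := k + 1) (by omega), ih (s := 1) (k := k) (by omega),
        epow_one_cons_cons, epow_zero]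
      ring
    · rw [add_assoc l.length k 2, add_assoc l.length k 1, ih (s := s) (k := k + 2) (by omega),
        ih (s := s + 1) (k := k + 1) (by omega), ih (s := s + 2) (k := k) (by omega),
        epow_add_two_cons_cons, hfg]
      ring

theorem YL_mul_YLinv (m : ℕ) (i : Fin m) : YL m i * YLinv m i = 1 := by
  simp [YL, YLinv, AddMonoidAlgebra.single_mul_single,
    AddMonoidAlgebra.one_def]

/-- **Lemma.** For `0 ≤ s ≤ m`, in `ℤ[u, v][Y_1^{±1}, …, Y_m^{±1}]`:
`e_{2m−s}(uY_1, vY_1^{−1}, …, uY_m, vY_m^{−1})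
  = (uv)^{m−s} · e_s(uY_1, vY_1^{−1}, …, uY_m, vY_m^{−1})`. -/
theorem esymm_reflection (m s : ℕ) (hs : s ≤ m) :
    epow (2 * m - s) (argL m) = (uL m * vL m) ^ (m - s) * epow s (argL m) := by
  have h := epow_flatMap_pair_reflection (c := uL m * vL m) (f := fun i => uL m * YL m i)
    (g := fun i => vL m * YLinv m i)
    (fun i => by rw [mul_mul_mul_comm, YL_mul_YLinv, mul_one]) (List.finRange m)
    (s := s) (k := m - s) (by rw [List.length_finRange]; omega)
  rwa [List.length_finRange, show m + (m - s) = 2 * m - s by omega] at h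

end
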